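/- Let E be an elliptic curve over F_q with n = #E(F_q) rational points and let 3 ≤ k ≤ n−1. Then every hyperplane H of P^{k−1}(F_q) contains at most k of the n points φ_k(P), P ∈ E(F_q); consequently, the k-elliptic code associated to E has dimension k and minimum distance at least n − k. -/

import Mathlib

set_option linter.unusedSectionVars false

namespace NMDS

open WeierstrassCurve

variable {F : Type} [Field F] [Fintype F] [DecidableEq F]

/-- `ψ_i(X,Y)`: `Y^s` if `i = 3s` (`s ≥ 1`), `X·Y^s` if `i = 3s+2` (`s ≥ 0`),
`X²·Y^s` if `i = 3s+4` (`s ≥ 0`). -/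
def psi (i : ℕ) (X Y : F) : F :=
  if i % 3 = 0 then Y ^ (i / 3)
  else if i % 3 = 2 then X * Y ^ (i / 3)
  else X ^ 2 * Y ^ ((i - 4) / 3)

/-- The coordinate vector of `φ_k(P)`: `(1, ψ₂(P), …, ψ_k(P))` for an affine point `P`,
and `(0, …, 0, 1)` for the point at infinity. -/
def phiVec (W : WeierstrassCurve F) (k : ℕ) : W.toAffine.Point → (Fin k → F)
  | .zero => fun j => if (j : ℕ) = k - 1 then 1 else 0
  | .some (x := x) (y := y) _ => fun j => if (j : ℕ) = 0 then 1 else psi ((j : ℕ) + 1) x y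

lemma phiVec_ne_zero (W : WeierstrassCurve F) {k : ℕ} (hk : 0 < k)
    (P : W.toAffine.Point) : phiVec W k P ≠ 0 := by
  cases P with
  | zero =>
    intro h
    have := congrFun h ⟨k - 1, by omega⟩
    simp [phiVec] at this
  | some h' =>
    intro h
    have := congrFun h ⟨0, hk⟩
    simp [phiVec] at this

/-- The image of a rational point of `E` in `P^{k-1}(F_q)` under `φ_k`. -/
noncomputable def phiProj (W : WeierstrassCurve F) {k : ℕ} (hk : 0 < k)
    (P : W.toAffine.Point) : Projectivization F (Fin k → F) :=
  Projectivization.mk F (phiVec W k P) (phiVec_ne_zero W hk P)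

/-- The `k`-elliptic code associated to `E`, relative to an enumeration `e` of the `n`
rational points of `E`: the span of the rows of the `k × n` matrix whose `j`-th column
is `φ_k(P_j)`. -/
def ellipticCode (W : WeierstrassCurve F) (k : ℕ) {n : ℕ}
    (e : Fin n ≃ W.toAffine.Point) : Submodule F (Fin n → F) :=
  Submodule.span F (Set.range fun i : Fin k => fun j : Fin n => phiVec W k (e j) i)

/-- The minimum distance (= minimum weight) of a linear code. -/
noncomputable def minDist {n : ℕ} (C : Submodule F (Fin n → F)) : ℕ :=
  sInf {d | ∃ x ∈ C, x ≠ 0 ∧ hammingNorm x = d}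

/-- The standard inner product with `y` as a linear map. -/
def dotLin {n : ℕ} (y : Fin n → F) : (Fin n → F) →ₗ[F] F where
  toFun x := ∑ i, x i * y i
  map_add' a b := by simp [add_mul, Finset.sum_add_distrib]
  map_smul' c a := by simp [Finset.mul_sum, mul_assoc]

/-- The dual code: all vectors orthogonal to every codeword. -/
def dualCode {n : ℕ} (C : Submodule F (Fin n → F)) : Submodule F (Fin n → F) :=
  ⨅ y ∈ C, LinearMap.ker (dotLin y)

/-- The Singleton defect `s(C) = n - k + 1 - d` of a code of length `n`. -/
noncomputable def singletonDefect {n : ℕ} (C : Submodule F (Fin n → F)) : ℤ :=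
  (n : ℤ) + 1 - Module.finrank F C - minDist C

/-- A code is MDS if its Singleton defect is zero. -/
noncomputable def IsMDS {n : ℕ} (C : Submodule F (Fin n → F)) : Prop :=
  singletonDefect C = 0

/-- A code is near-MDS if both it and its dual have Singleton defect one. -/
noncomputable def IsNMDS {n : ℕ} (C : Submodule F (Fin n → F)) : Prop :=
  singletonDefect C = 1 ∧ singletonDefect (dualCode C) = 1

/-- An `[n,k,d]_q` code `C` is `h`-extendable if there is an `[n+h,k,d+h]_q` code `C'`
whose projection on the first `n` coordinates is `C`. -/
noncomputable def IsHExtendable {n : ℕ} (h : ℕ) (C : Submodule F (Fin n → F)) : Prop :=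
  ∃ C' : Submodule F (Fin (n + h) → F),
    Module.finrank F C' = Module.finrank F C ∧
    minDist C' = minDist C + h ∧
    Submodule.map (LinearMap.funLeft F F (Fin.castAdd h)) C' = C

/-- The point `p` of `P^{k-1}(F_q)` lies on the hyperplane with coefficient vector `a`. -/
def OnHyp {k : ℕ} (a : Fin k → F) (p : Projectivization F (Fin k → F)) : Prop :=
  ∑ i, a i * p.rep i = 0

/-- An `(·; k, k-2)`-set in `P^{k-1}(F_q)`: no `k+1` of its points lie on a common hyperplane,
i.e. every hyperplane contains at most `k` of its points. -/
def IsArcSet (k : ℕ) (S : Set (Projectivization F (Fin k → F))) : Prop :=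
  ∀ a : Fin k → F, a ≠ 0 → Set.ncard {p ∈ S | OnHyp a p} ≤ k

/-- A complete `(·; k, k-2)`-set: maximal with respect to set-theoretical inclusion. -/
def IsCompleteArcSet (k : ℕ) (S : Set (Projectivization F (Fin k → F))) : Prop :=
  IsArcSet k S ∧ ∀ T, IsArcSet k T → S ⊆ T → T = S

/-- Evaluation of the homogeneous cubic of a Weierstrass curve:
`Y²Z + a₁XYZ + a₃YZ² - X³ - a₂X²Z - a₄XZ² - a₆Z³`. -/
def cubicEval {R : Type*} [CommRing R] (W : WeierstrassCurve R) (x y z : R) : R :=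
  y ^ 2 * z + W.a₁ * x * y * z + W.a₃ * y * z ^ 2
    - (x ^ 3 + W.a₂ * x ^ 2 * z + W.a₄ * x * z ^ 2 + W.a₆ * z ^ 3)

/-- The gradient of the homogeneous cubic of a Weierstrass curve. -/
def gradEval {R : Type*} [CommRing R] (W : WeierstrassCurve R) (x y z : R) : Fin 3 → R :=
  ![W.a₁ * y * z - (3 * x ^ 2 + 2 * W.a₂ * x * z + W.a₄ * z ^ 2),
    2 * y * z + W.a₁ * x * z + W.a₃ * z ^ 2,
    y ^ 2 + W.a₁ * x * y + 2 * W.a₃ * y * z - (W.a₂ * x ^ 2 + 2 * W.a₄ * x * z + 3 * W.a₆ * z ^ 2)]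

/-- The point `p` of `P²(F_q)` lies on the plane cubic `E`. -/
def OnCurve (W : WeierstrassCurve F) (p : Projectivization F (Fin 3 → F)) : Prop :=
  cubicEval W (p.rep 0) (p.rep 1) (p.rep 2) = 0

/-- A line of `P²(F_q)`, given by its coefficient vector `l`, is a tangent of `E`:
it touches the curve at some point (over the algebraic closure) with multiplicity at
least two, i.e. it is the tangent line of the cubic at a contact point. -/
def IsTangentLine (W : WeierstrassCurve F) (l : Fin 3 → F) : Prop :=
  ∃ v : Fin 3 → AlgebraicClosure F, v ≠ 0 ∧
    cubicEval (W.baseChange (AlgebraicClosure F)) (v 0) (v 1) (v 2) = 0 ∧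
    (∑ i, algebraMap F (AlgebraicClosure F) (l i) * v i) = 0 ∧
    ∃ t : AlgebraicClosure F, t ≠ 0 ∧
      gradEval (W.baseChange (AlgebraicClosure F)) (v 0) (v 1) (v 2) =
        t • fun i => algebraMap F (AlgebraicClosure F) (l i)

/-- A line of `P²(F_q)` intersects `E` in three distinct `F_q`-rational points. -/
def IsThreeSecant (W : WeierstrassCurve F) (l : Fin 3 → F) : Prop :=
  ∃ u v w : Projectivization F (Fin 3 → F), u ≠ v ∧ u ≠ w ∧ v ≠ w ∧
    OnCurve W u ∧ OnCurve W v ∧ OnCurve W w ∧ OnHyp l u ∧ OnHyp l v ∧ OnHyp l w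


section PoleOrder

open Polynomial

/-- The exponent of `X` in the monomial giving the `j`-th coordinate of `φ_k` (from `j = 0`). -/
def expX (j : ℕ) : ℕ := if j = 0 then 0 else 2 * (j + 1) % 3

/-- The exponent of `Y` in the monomial giving the `j`-th coordinate of `φ_k` (from `j = 0`). -/
def expY (j : ℕ) : ℕ := if j = 0 then 0 else (j + 1 - 2 * (2 * (j + 1) % 3)) / 3

/-- The pole order at infinity of the `j`-th coordinate of `φ_k` (from `j = 0`). -/
def poleOrder (j : ℕ) : ℕ := if j = 0 then 0 else j + 1

lemma two_mul_expX_add (j : ℕ) : 2 * expX j + 3 * expY j = poleOrder j := by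
  unfold expX expY poleOrder
  split_ifs <;> omega

lemma poleOrder_strictMono : StrictMono poleOrder := by
  intro i j h
  unfold poleOrder
  split_ifs <;> omega

lemma poleOrder_le (j : ℕ) : poleOrder j ≤ j + 1 := by
  unfold poleOrder
  split_ifs <;> omega

lemma phiVec_some (W : WeierstrassCurve F) (k : ℕ) {x y : F} (h : W.toAffine.Nonsingular x y)
    (j : Fin k) : phiVec W k (.some x y h) j = x ^ expX j * y ^ expY j := by
  simp only [phiVec, psi, expX, expY]
  by_cases hj : (j : ℕ) = 0
  · simp [hj]
  · simp only [hj, if_false]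
    have h3 : ((j : ℕ) + 1) % 3 = 0 ∨ ((j : ℕ) + 1) % 3 = 2 ∨ ((j : ℕ) + 1) % 3 = 1 := by omega
    rcases h3 with h3 | h3 | h3
    · rw [if_pos h3, show 2 * ((j : ℕ) + 1) % 3 = 0 by omega]
      simp
    · rw [if_neg (by omega), if_pos h3, show 2 * ((j : ℕ) + 1) % 3 = 1 by omega, pow_one]
      congr 2
      omega
    · rw [if_neg (by omega), if_neg (by omega), show 2 * ((j : ℕ) + 1) % 3 = 2 by omega]

variable (W : WeierstrassCurve F)

/-- The degree of the norm of a sum is at most the larger of the degrees of the norms. -/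
lemma degree_norm_add_le (f g : W.toAffine.CoordinateRing) :
    (Algebra.norm F[X] (f + g)).degree ≤
      max (Algebra.norm F[X] f).degree (Algebra.norm F[X] g).degree := by
  obtain ⟨p, q, rfl⟩ := Affine.CoordinateRing.exists_smul_basis_eq f
  obtain ⟨r, s, rfl⟩ := Affine.CoordinateRing.exists_smul_basis_eq g
  rw [add_add_add_comm, ← add_smul, ← add_smul]
  simp only [Affine.CoordinateRing.degree_norm_smul_basis]
  have hp := degree_add_le p r
  have hq := degree_add_le q s
  rcases le_max_iff.1 hp with h | h <;> rcases le_max_iff.1 hq with h' | h' <;>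
  · refine max_le ?_ ?_
    · grw [h]; simp
    · grw [h']; simp

lemma degree_norm_smul_le (c : F) (f : W.toAffine.CoordinateRing) :
    (Algebra.norm F[X] (c • f)).degree ≤ (Algebra.norm F[X] f).degree := by
  rw [← algebraMap_smul F[X] c f, Algebra.smul_def, map_mul,
    Algebra.norm_algebraMap_of_basis (Affine.CoordinateRing.basis W.toAffine), degree_mul,
    algebraMap_eq, ← C_pow]
  grw [degree_C_le, zero_add]

lemma degree_norm_sum_le {ι : Type*} (s : Finset ι) (f : ι → W.toAffine.CoordinateRing)
    (d : WithBot ℕ) (h : ∀ i ∈ s, (Algebra.norm F[X] (f i)).degree ≤ d) :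
    (Algebra.norm F[X] (∑ i ∈ s, f i)).degree ≤ d := by
  classical
  induction s using Finset.induction_on with
  | empty =>
    have := Module.Finite.of_basis (Affine.CoordinateRing.basis W.toAffine)
    simp [Algebra.norm_zero]
  | insert i s hi ih =>
    rw [Finset.sum_insert hi]
    exact (degree_norm_add_le W _ _).trans (max_le (h i (by simp))
      (ih fun j hj => h j (by simp [hj])))

/-- The `j`-th coordinate of `φ_k` as an element of the affine coordinate ring. -/
noncomputable def coordFun (j : ℕ) : W.toAffine.CoordinateRing :=
  (algebraMap F[X] _ X) ^ expX j * (Affine.CoordinateRing.mk W.toAffine X) ^ expY j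

lemma degree_norm_coordFun (j : ℕ) :
    (Algebra.norm F[X] (coordFun W j)).degree = poleOrder j := by
  have hX : (Algebra.norm F[X] (algebraMap F[X] W.toAffine.CoordinateRing X)).degree = 2 := by
    rw [Algebra.norm_algebraMap_of_basis (Affine.CoordinateRing.basis W.toAffine)]
    simp
  have hY : (Algebra.norm F[X] (Affine.CoordinateRing.mk W.toAffine X)).degree = 3 := by
    have := Affine.CoordinateRing.degree_norm_smul_basis (W' := W.toAffine) (0 : F[X]) 1
    rw [zero_smul, one_smul, zero_add] at this
    rw [this]
    simp
  rw [coordFun, map_mul, map_pow, map_pow, degree_mul, degree_pow, degree_pow, hX, hY,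
    ← two_mul_expX_add]
  push_cast
  simp [mul_comm]

/-- A nontrivial linear combination of coordinates of `φ_k` with last nonzero coefficient at
`m` is a nonzero function with pole order at most that of the `m`-th coordinate. -/
lemma sum_coordFun_ne_zero_and_degree_le {k : ℕ} (a : Fin k → F) (m : Fin k) (hm : a m ≠ 0)
    (hlast : ∀ j, m < j → a j = 0) :
    ∑ j, a j • coordFun W j ≠ 0 ∧
      (Algebra.norm F[X] (∑ j, a j • coordFun W j)).natDegree ≤ poleOrder m := by
  have hfin := Module.Finite.of_basis (Affine.CoordinateRing.basis W.toAffine)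
  refine ⟨fun h0 => ?_, natDegree_le_of_degree_le (degree_norm_sum_le W _ _ _ fun j _ => ?_)⟩
  · have hsum : coordFun W m = -(a m)⁻¹ • ∑ j ∈ Finset.univ.erase m, a j • coordFun W j := by
      rw [← Finset.add_sum_erase _ _ (Finset.mem_univ m)] at h0
      rw [neg_smul, ← smul_neg, ← eq_neg_of_add_eq_zero_left h0, inv_smul_smul₀ hm]
    have hdeg := degree_norm_coordFun W m
    have hlt : (Algebra.norm F[X] (coordFun W m)).degree < ((poleOrder m : ℕ) : WithBot ℕ) := by
      rw [hsum]
      refine (degree_norm_smul_le W _ _).trans_lt ?_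
      rcases Nat.eq_zero_or_pos (m : ℕ) with hm0 | hm0
      · rw [Finset.sum_eq_zero fun j hj => ?_]
        · simp [Algebra.norm_zero]
        · have : m < j := by
            have := Finset.ne_of_mem_erase hj
            rw [Fin.lt_def]
            have h2 : (j : ℕ) ≠ m := fun h => this (Fin.ext h)
            omega
          rw [hlast j this, zero_smul]
      · refine (degree_norm_sum_le W _ _ ((poleOrder (m - 1) : ℕ) : WithBot ℕ)
          fun j hj => ?_).trans_lt (by exact_mod_cast poleOrder_strictMono (by omega))
        by_cases hjm : m < j
        · simp [hlast j hjm, Algebra.norm_zero]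
        · refine (degree_norm_smul_le W _ _).trans ?_
          rw [degree_norm_coordFun]
          have h1 : (j : ℕ) ≠ m := fun h => Finset.ne_of_mem_erase hj (Fin.ext h)
          have h2 : (j : ℕ) ≤ m := not_lt.1 hjm
          exact_mod_cast poleOrder_strictMono.monotone (by omega)
    exact hlt.ne hdeg
  · by_cases hjm : m < j
    · simp [hlast j hjm, Algebra.norm_zero]
    · refine (degree_norm_smul_le W _ _).trans ?_
      rw [degree_norm_coordFun]
      exact_mod_cast poleOrder_strictMono.monotone (not_lt.1 hjm)

/-- Evaluation of regular functions at an affine point. -/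
noncomputable def evalAt {x y : F} (h : W.toAffine.Equation x y) :
    W.toAffine.CoordinateRing →ₐ[F] F :=
  AdjoinRoot.liftAlgHom W.toAffine.polynomial (aeval x : F[X] →ₐ[F] F) y (by
    rw [← h]
    simp [evalEval, eval₂_eq_eval_map, ← coe_evalRingHom, map_evalRingHom_eval])

lemma evalAt_X {x y : F} (h : W.toAffine.Equation x y) :
    evalAt W h (algebraMap F[X] _ X) = x := by
  rw [evalAt, AdjoinRoot.algebraMap_eq, AdjoinRoot.liftAlgHom_of]
  simp

lemma evalAt_Y {x y : F} (h : W.toAffine.Equation x y) :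
    evalAt W h (Affine.CoordinateRing.mk W.toAffine X) = y := by
  rw [evalAt, AdjoinRoot.liftAlgHom_mk]
  simp

lemma evalAt_coordFun (k : ℕ) {x y : F} (h : W.toAffine.Nonsingular x y) (j : Fin k) :
    evalAt W h.1 (coordFun W j) = phiVec W k (.some x y h) j := by
  rw [coordFun, map_mul, map_pow, map_pow, evalAt_X, evalAt_Y, phiVec_some]

/-- A nonzero regular function has at most as many affine zeros as the degree of its norm. -/
lemma ncard_zeros_le {f : W.toAffine.CoordinateRing} (hf : f ≠ 0) :
    Set.ncard {P : W.toAffine.Point |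
      ∃ (x y : F) (h : W.toAffine.Nonsingular x y), P = .some x y h ∧ evalAt W h.1 f = 0} ≤
      (Algebra.norm F[X] f).natDegree := by
  rw [← finrank_quotient_span_eq_natDegree_norm (F := F)
    (Affine.CoordinateRing.basis W.toAffine) hf]
  have hfin : Module.Finite F (W.toAffine.CoordinateRing ⧸ Ideal.span {f}) :=
    Module.Finite.equiv (Ideal.quotientEquivDirectSum F (Affine.CoordinateRing.basis W.toAffine)
      (mt Ideal.span_singleton_eq_bot.1 hf)).symm
  refine le_trans ?_ (card_algHom_le_finrank F (W.toAffine.CoordinateRing ⧸ Ideal.span {f}) F)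
  rw [← Nat.card_coe_set_eq]
  choose x y h hP h0 using fun P : {P : W.toAffine.Point |
      ∃ (x y : F) (h : W.toAffine.Nonsingular x y), P = .some x y h ∧ evalAt W h.1 f = 0} => P.2
  have hker : ∀ P, ∀ g ∈ Ideal.span {f}, evalAt W (h P).1 g = 0 := by
    intro P g hg
    obtain ⟨r, rfl⟩ := Ideal.mem_span_singleton.1 hg
    rw [map_mul, h0, zero_mul]
  refine Nat.card_le_card_of_injective
    (fun P => Ideal.Quotient.liftₐ (Ideal.span {f}) (evalAt W (h P).1) (hker P)) ?_
  intro P Q hPQ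
  have hev : ∀ g, evalAt W (h P).1 g = evalAt W (h Q).1 g := fun g =>
    DFunLike.congr_fun hPQ (Ideal.Quotient.mk (Ideal.span {f}) g)
  have hx := hev (algebraMap F[X] _ X)
  have hy := hev (Affine.CoordinateRing.mk W.toAffine X)
  rw [evalAt_X, evalAt_X] at hx
  rw [evalAt_Y, evalAt_Y] at hy
  apply Subtype.ext
  rw [hP P, hP Q]
  simp [hx, hy]

end PoleOrder

/-- A hyperplane of `P^{k-1}(F_q)` meets the curve in at most `k` rational points. -/
lemma ncard_hyperplane_section_le (W : WeierstrassCurve F) [Finite W.toAffine.Point] {k : ℕ}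
    (a : Fin k → F) (ha : a ≠ 0) :
    Set.ncard {P : W.toAffine.Point | ∑ i, a i * phiVec W k P i = 0} ≤ k := by
  classical
  have hne : (Finset.univ.filter fun j => a j ≠ 0).Nonempty := by
    obtain ⟨j, hj⟩ := Function.ne_iff.1 ha
    exact ⟨j, by simpa using hj⟩
  obtain ⟨m, hm, hmax⟩ := Finset.exists_max_image _ id hne
  have ham : a m ≠ 0 := (Finset.mem_filter.1 hm).2
  have hlast : ∀ j, m < j → a j = 0 := fun j hj => by
    by_contra h
    exact absurd (hmax j (by simpa using h)) (not_le.2 hj)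
  obtain ⟨hf, hdeg⟩ := sum_coordFun_ne_zero_and_degree_le W a m ham hlast
  have hzeros := (ncard_zeros_le W hf).trans hdeg
  set Z := {P : W.toAffine.Point | ∃ (x y : F) (h : W.toAffine.Nonsingular x y),
    P = .some x y h ∧ evalAt W h.1 (∑ j, a j • coordFun W j) = 0}
  have hmem : ∀ (x y : F) (h : W.toAffine.Nonsingular x y),
      ∑ i, a i * phiVec W k (.some x y h) i = 0 → Affine.Point.some x y h ∈ Z := by
    intro x y h h0
    refine ⟨x, y, h, rfl, ?_⟩
    simpa [map_sum, map_smul, evalAt_coordFun W k h] using h0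
  have hpole := poleOrder_le m
  by_cases hmk : (m : ℕ) = k - 1
  · refine (Set.ncard_le_ncard ?_ (Set.toFinite Z)).trans (by omega)
    rintro (_ | ⟨x, y, h⟩) h0
    · refine absurd h0 ?_
      have hz : ∀ i : Fin k, phiVec W k .zero i = if i = m then 1 else 0 := fun i => by
        simp only [phiVec, Fin.ext_iff, hmk]
      simp [hz, ham]
    · exact hmem x y h h0
  · refine (Set.ncard_le_ncard (t := insert .zero Z) ?_ (Set.toFinite _)).trans
      ((Set.ncard_insert_le _ _).trans (by omega))
    rintro (_ | ⟨x, y, h⟩) h0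
    · exact Set.mem_insert _ _
    · exact Set.mem_insert_of_mem _ (hmem x y h h0)

lemma onHyp_phiProj_iff (W : WeierstrassCurve F) {k : ℕ} (hk : 0 < k) (a : Fin k → F)
    (P : W.toAffine.Point) :
    OnHyp a (phiProj W hk P) ↔ ∑ i, a i * phiVec W k P i = 0 := by
  obtain ⟨c, hc⟩ := Projectivization.exists_smul_eq_mk_rep F _ (phiVec_ne_zero W hk P)
  have hsum : ∑ i, a i * (phiProj W hk P).rep i = (c : F) * ∑ i, a i * phiVec W k P i := by
    rw [phiProj, ← hc, Finset.mul_sum]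
    refine Finset.sum_congr rfl fun i _ => ?_
    simp only [Pi.smul_apply, Units.smul_def, smul_eq_mul]
    ring
  rw [OnHyp, hsum, mul_eq_zero, or_iff_right c.ne_zero]

/-- The codeword with coefficients `a` vanishes in at most `k` positions. -/
lemma sub_le_hammingNorm (W : WeierstrassCurve F) {n k : ℕ} (e : Fin n ≃ W.toAffine.Point)
    (a : Fin k → F) (ha : a ≠ 0) :
    n - k ≤ hammingNorm fun j => ∑ i, a i * phiVec W k (e j) i := by
  have hfin : Finite W.toAffine.Point := Finite.of_equiv _ e
  have h1 := ncard_hyperplane_section_le W a ha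
  have h2 : (Finset.univ.filter fun j : Fin n => ∑ i, a i * phiVec W k (e j) i = 0).card ≤ k := by
    refine le_trans ?_ h1
    rw [← Set.ncard_coe_finset]
    refine Set.ncard_le_ncard_of_injOn e ?_ e.injective.injOn (Set.toFinite _)
    intro j hj
    simpa using hj
  have h3 := Finset.card_filter_add_card_filter_not (s := (Finset.univ : Finset (Fin n)))
    (fun j => ∑ i, a i * phiVec W k (e j) i = 0)
  rw [Finset.card_univ, Fintype.card_fin] at h3
  unfold hammingNorm
  simp only [ne_eq]
  omega

/-- For `3 ≤ k ≤ n - 1`, every hyperplane of `P^{k-1}(F_q)` contains at most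
`k` of the points `φ_k(P)`, `P ∈ E(F_q)`; consequently the `k`-elliptic code has dimension `k`
and minimum distance at least `n - k`. -/
theorem statement2 (W : WeierstrassCurve F) [W.IsElliptic] {n : ℕ}
    (hn : n = Nat.card W.toAffine.Point) (e : Fin n ≃ W.toAffine.Point)
    {k : ℕ} (hk3 : 3 ≤ k) (hkn : k ≤ n - 1) :
    (∀ a : Fin k → F, a ≠ 0 →
        Set.ncard {p ∈ Set.range (phiProj W (show 0 < k by omega)) | OnHyp a p} ≤ k) ∧
      Module.finrank F (ellipticCode W k e) = k ∧
      n - k ≤ minDist (ellipticCode W k e) := by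
  have hfin : Finite W.toAffine.Point := Finite.of_equiv _ e
  have hsum : ∀ a : Fin k → F, (∑ i, a i • fun j : Fin n => phiVec W k (e j) i) =
      fun j => ∑ i, a i * phiVec W k (e j) i := fun a => by
    ext j
    simp
  have hind : LinearIndependent F fun i : Fin k => fun j : Fin n => phiVec W k (e j) i := by
    rw [Fintype.linearIndependent_iff]
    intro a h0
    by_contra! hne
    obtain ⟨i, hi⟩ := hne
    have := sub_le_hammingNorm W e a (fun h => hi (congrFun h i))
    rw [← hsum, h0, hammingNorm_zero] at this
    omega
  have hrank : Module.finrank F (ellipticCode W k e) = k := by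
    rw [ellipticCode, finrank_span_eq_card hind, Fintype.card_fin]
  refine ⟨fun a ha => ?_, hrank, ?_⟩
  · refine le_trans ?_ (ncard_hyperplane_section_le W a ha)
    refine le_trans (Set.ncard_le_ncard ?_ (Set.toFinite _)) (Set.ncard_image_le
      (f := phiProj W (show 0 < k by omega)) (Set.toFinite _))
    rintro _ ⟨⟨P, rfl⟩, hP⟩
    exact ⟨P, (onHyp_phiProj_iff W _ a P).1 hP, rfl⟩
  · have hbot : ellipticCode W k e ≠ ⊥ := fun h => by
      rw [h, finrank_bot] at hrank
      omega
    obtain ⟨x, hx, hx0⟩ := Submodule.exists_mem_ne_zero_of_ne_bot hbot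
    refine le_csInf ⟨_, x, hx, hx0, rfl⟩ ?_
    rintro _ ⟨x, hx, hx0, rfl⟩
    obtain ⟨a, rfl⟩ := (Submodule.mem_span_range_iff_exists_fun F).1 hx
    rw [hsum]
    refine sub_le_hammingNorm W e a fun h => hx0 ?_
    simp [h]

end NMDS
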